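/- arXiv:1511.08234 — 2 statements merged into one kernel-verified Lean document; each statement's English description precedes it below -/
import Mathlib

section
/- Let $X$ be an $n\times n$ matrix over a field, and for $1\le i\le j$ define $f_{ij}=\det X_{[i,k]}^{[j,\ell]}$ where $k,\ell$ make the submatrix maximal contiguous with $x_{ij}$ in the upper-left corner (i.e., for $j>i$: rows $[i, n-j+i]$, columns $[j,n]$). For $2\le k< j\le n-1$ with $k<j-1$, the identity $f_{kj}\, f_{k-1,j-1}^{(1)} = f_{k-1,j-1} f_{kj}^{(1)} + f_{k-1,j} f_{k,j-1}^{(1)}$ holds, where $g^{(1)}$ denotes the determinant of the submatrix obtained by deleting the last row and last column of the defining submatrix of $g$. -/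
/-- The contiguous minor of `X` with rows `r+1, …, r+s` and columns `c+1, …, c+s`
(1-based; here `r, c` are 0-based starting indices and `s` is the size). -/
def cminor {K : Type*} [Field K] {n : ℕ} (X : Matrix (Fin n) (Fin n) K)
    (r c s : ℕ) (hr : r + s ≤ n) (hc : c + s ≤ n) : K :=
  (Matrix.of fun a b : Fin s =>
    X ⟨r + a.1, by have := a.2; omega⟩ ⟨c + b.1, by have := b.2; omega⟩).det

theorem jacobi_blocks {R : Type*} [CommRing R] {m p : Type*} [Fintype m] [DecidableEq m]
    [Fintype p] [DecidableEq p] (A : Matrix (m ⊕ p) (m ⊕ p) R) :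
    A.det * A.adjugate.toBlocks₂₂.det = A.toBlocks₁₁.det * A.det ^ Fintype.card p := by
  have h : A * Matrix.fromBlocks 1 A.adjugate.toBlocks₁₂ 0 A.adjugate.toBlocks₂₂
      = Matrix.fromBlocks A.toBlocks₁₁ 0 A.toBlocks₂₁ (A.det • 1) := by
    have h0 := A.mul_adjugate
    ext i j
    rcases j with j | j
    · rcases i with i | i <;>
        simp [Matrix.mul_apply, Matrix.toBlocks₁₁, Matrix.toBlocks₂₁, Matrix.one_apply]
    · have h1 := congrFun (congrFun h0 i) (Sum.inr j)
      rw [Matrix.mul_apply] at h1 ⊢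
      rcases i with i | i <;>
        simpa [Matrix.toBlocks₁₂, Matrix.toBlocks₂₂, Matrix.one_apply] using h1
  have h2 := congrArg Matrix.det h
  rw [Matrix.det_mul, Matrix.det_fromBlocks_zero₂₁, Matrix.det_fromBlocks_zero₁₂] at h2
  simpa using h2

theorem jacobi_blocks_two {R : Type*} [CommRing R] {m : Type*} [Fintype m] [DecidableEq m]
    (A : Matrix (m ⊕ Fin 2) (m ⊕ Fin 2) R) :
    A.adjugate.toBlocks₂₂.det = A.toBlocks₁₁.det * A.det := by
  let G := Matrix.mvPolynomialX (m ⊕ Fin 2) (m ⊕ Fin 2) ℤ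
  have hG : G.adjugate.toBlocks₂₂.det = G.toBlocks₁₁.det * G.det := by
    have h := jacobi_blocks G
    apply mul_left_cancel₀ (Matrix.det_mvPolynomialX_ne_zero (m ⊕ Fin 2) ℤ)
    change G.det * _ = G.det * _
    rw [h]
    simp
    ring
  let φ : MvPolynomial ((m ⊕ Fin 2) × (m ⊕ Fin 2)) ℤ →+* R :=
    MvPolynomial.eval₂Hom (Int.castRingHom R) (fun q => A q.1 q.2)
  have hA : φ.mapMatrix G = A := by
    ext i j
    simp [φ, G]
  have h := congrArg φ hG
  rw [map_mul, RingHom.map_det, RingHom.map_det, RingHom.map_det, hA] at h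
  have e1 : φ.mapMatrix G.adjugate.toBlocks₂₂ = A.adjugate.toBlocks₂₂ := by
    rw [← hA, ← RingHom.map_adjugate]
    rfl
  have e2 : φ.mapMatrix G.toBlocks₁₁ = A.toBlocks₁₁ := by
    rw [← hA]
    rfl
  rwa [e1, e2] at h

theorem desnanot_jacobi {R : Type*} [CommRing R] {m : ℕ}
    (A : Matrix (Fin (m + 2)) (Fin (m + 2)) R) :
    (A.submatrix Fin.succ Fin.succ).det * (A.submatrix Fin.castSucc Fin.castSucc).det
    = A.det * (A.submatrix (fun i : Fin m => i.succ.castSucc) (fun i : Fin m => i.succ.castSucc)).det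
      + (A.submatrix Fin.castSucc Fin.succ).det * (A.submatrix Fin.succ Fin.castSucc).det := by
  let f : Fin m ⊕ Fin 2 → Fin (m + 2) :=
    Sum.elim (fun i => i.succ.castSucc) ![0, Fin.last (m + 1)]
  have hf : Function.Injective f := by
    rintro (a | a) (b | b) h
    · simpa [f] using h
    · fin_cases b <;> simp [f, Fin.ext_iff] at h
      have := a.2
      omega
    · fin_cases a <;> simp [f, Fin.ext_iff] at h
      have := b.2
      omega
    · fin_cases a <;> fin_cases b <;> simp [f, Fin.ext_iff] at h ⊢
  let e : Fin m ⊕ Fin 2 ≃ Fin (m + 2) :=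
    Equiv.ofBijective f ((Fintype.bijective_iff_injective_and_card f).2 ⟨hf, by simp⟩)
  have h := jacobi_blocks_two (A.submatrix e e)
  rw [Matrix.adjugate_submatrix_equiv_self, Matrix.det_submatrix_equiv_self,
    Matrix.det_fin_two] at h
  have e0 : e (Sum.inr 0) = 0 := rfl
  have e1 : e (Sum.inr 1) = Fin.last (m + 1) := rfl
  have e2 : (A.submatrix e e).toBlocks₁₁
    = A.submatrix (fun i : Fin m => i.succ.castSucc) (fun i : Fin m => i.succ.castSucc) := rfl
  rw [e2] at h
  simp only [Matrix.toBlocks₂₂, Matrix.of_apply, Matrix.submatrix_apply, e0, e1,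
    Matrix.adjugate_fin_succ_eq_det_submatrix, Fin.succAbove_last, Fin.val_zero, Fin.val_last,
    Fin.succAbove_zero] at h
  have s1 : ((-1 : R) ^ (m + 1)) * (-1) ^ (m + 1) = 1 := by
    rw [← mul_pow]; simp
  simp only [Nat.add_zero, Nat.zero_add, pow_zero, one_mul, pow_add _ (m + 1) (m + 1), s1] at h
  linear_combination h + (A.submatrix Fin.castSucc Fin.succ).det *
    (A.submatrix Fin.succ Fin.castSucc).det * s1

/-- The Desnanot–Jacobi instance
`f_{kj} f_{k-1,j-1}^{(1)} = f_{k-1,j-1} f_{kj}^{(1)} + f_{k-1,j} f_{k,j-1}^{(1)}`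
for `2 ≤ k < j - 1` and `j ≤ n - 1`, with 1-based indices `k, j`, where
`f_{ij} = det X_{[i, n-j+i]}^{[j,n]}` and `g^{(1)}` deletes the last row and column. -/
theorem minor_exchange_identity {K : Type*} [Field K] (n : ℕ)
    (X : Matrix (Fin n) (Fin n) K) (k j : ℕ)
    (hk : 2 ≤ k) (hkj : k + 1 < j) (hj : j ≤ n - 1) (hn : 2 ≤ n) :
    cminor X (k-1) (j-1) (n-j+1) (by omega) (by omega) *
      cminor X (k-2) (j-2) (n-j+1) (by omega) (by omega)
    = cminor X (k-2) (j-2) (n-j+2) (by omega) (by omega) *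
        cminor X (k-1) (j-1) (n-j) (by omega) (by omega)
      + cminor X (k-2) (j-1) (n-j+1) (by omega) (by omega) *
        cminor X (k-1) (j-2) (n-j+1) (by omega) (by omega) := by
  obtain ⟨k, rfl⟩ : ∃ k', k = k' + 2 := ⟨k - 2, by omega⟩
  obtain ⟨j, rfl⟩ : ∃ j', j = j' + 2 := ⟨j - 2, by omega⟩
  have h := desnanot_jacobi (Matrix.of fun a b : Fin (n - (j + 2) + 2) =>
    X ⟨k + a.1, by have := a.2; omega⟩ ⟨j + b.1, by have := b.2; omega⟩)
  unfold cminor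
  convert h using 3
  all_goals
    congr 1
    try
      ext a b
      simp only [Matrix.of_apply, Matrix.submatrix_apply]
      congr 1 <;> simp [Fin.ext_iff] <;> omega
end

section
/- Let $X$ be an $n\times n$ matrix over a commutative ring and let $1\le i\le \beta < n$, $j=n+i-\beta$, $1\le\alpha<n$. Define the block matrix $M=\begin{pmatrix} X_{[i,\beta+1]}^{[j,n]} & 0\\ 0 & X_{[\alpha,n]}^{[1,n-\alpha]}\end{pmatrix}$ where the zero blocks make $M$ square (each block has one more row than columns). Then $\det M = \det X_{[i,\beta]}^{[j,n]}\cdot\det X_{[\alpha+1,n]}^{[1,n-\alpha]} - \det X_{[i,\ldots,\beta-1,\beta+1]}^{[j,n]}\cdot\det X_{[\alpha,\alpha+2,\ldots,n]}^{[1,n-\alpha]}$. -/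
lemma psi_aux {K : Type*} [CommRing K] (p m : ℕ) (A B : ℕ → ℕ → K) :
    (Matrix.of fun a b : Fin ((p + 1) + (m + 1)) =>
      if b.1 < p + 1 then (if a.1 ≤ p + 1 then A a.1 b.1 else 0)
      else (if p ≤ a.1 then B (a.1 - p) (b.1 - (p + 1)) else 0)).det
    = (Matrix.of fun a b : Fin (p + 1) => A a.1 b.1).det *
        (Matrix.of fun a b : Fin (m + 1) => B (a.1 + 1) b.1).det
      - (Matrix.of fun a b : Fin (p + 1) => A (if a.1 < p then a.1 else p + 1) b.1).det *
        (Matrix.of fun a b : Fin (m + 1) => B (if a.1 = 0 then 0 else a.1 + 1) b.1).det := by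
  set M := (Matrix.of fun a b : Fin ((p + 1) + (m + 1)) =>
      if b.1 < p + 1 then (if a.1 ≤ p + 1 then A a.1 b.1 else 0)
      else (if p ≤ a.1 then B (a.1 - p) (b.1 - (p + 1)) else 0)) with hM
  let r : Fin ((p + 1) + (m + 1)) := ⟨p, by omega⟩
  let s : Fin ((p + 1) + (m + 1)) := ⟨p + 1, by omega⟩
  let u : Fin ((p + 1) + (m + 1)) → K := fun b => if b.1 < p + 1 then A p b.1 else 0
  let v : Fin ((p + 1) + (m + 1)) → K := fun b => if b.1 < p + 1 then 0 else B 0 (b.1 - (p + 1))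
  have hsplit : M = M.updateRow r (u + v) := by
    ext a b
    by_cases h : a = r
    · subst h
      simp only [Matrix.updateRow_self, hM, Matrix.of_apply, Pi.add_apply, u, v, r]
      split_ifs <;> simp_all
    · simp [Matrix.updateRow_ne h]
  have h1 : (M.updateRow r u).det = (Matrix.of fun a b : Fin (p + 1) => A a.1 b.1).det *
        (Matrix.of fun a b : Fin (m + 1) => B (a.1 + 1) b.1).det := by
    rw [← Matrix.det_submatrix_equiv_self finSumFinEquiv,
      ← Matrix.fromBlocks_toBlocks ((M.updateRow r u).submatrix finSumFinEquiv finSumFinEquiv)]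
    have h0 : ((M.updateRow r u).submatrix finSumFinEquiv finSumFinEquiv).toBlocks₁₂ = 0 := by
      ext a b
      have := a.2
      simp only [Matrix.toBlocks₁₂, Matrix.of_apply, Matrix.submatrix_apply, hM, Matrix.updateRow_apply,
        finSumFinEquiv_apply_left, finSumFinEquiv_apply_right, r, u, Fin.ext_iff, Fin.val_castAdd,
        Fin.val_natAdd, Matrix.zero_apply]
      split_ifs <;> first | rfl | omega
    rw [h0, Matrix.det_fromBlocks_zero₁₂]
    congr 2
    · ext a b
      have := a.2
      have := b.2
      simp only [Matrix.toBlocks₁₁, Matrix.of_apply, Matrix.submatrix_apply, hM, Matrix.updateRow_apply,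
        finSumFinEquiv_apply_left, finSumFinEquiv_apply_right, r, u, Fin.ext_iff, Fin.val_castAdd,
        Fin.val_natAdd]
      split_ifs <;> first | rfl | omega | (congr 1; omega) | (congr 1 <;> congr 1 <;> omega)
    · ext a b
      simp only [Matrix.toBlocks₂₂, Matrix.of_apply, Matrix.submatrix_apply, hM, Matrix.updateRow_apply,
        finSumFinEquiv_apply_left, finSumFinEquiv_apply_right, r, u, Fin.ext_iff, Fin.val_castAdd,
        Fin.val_natAdd]
      split_ifs <;> first | rfl | omega | (congr 1 <;> first | omega | (congr 1; omega))
  have h2 : (M.updateRow r v).det =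
      - ((Matrix.of fun a b : Fin (p + 1) => A (if a.1 < p then a.1 else p + 1) b.1).det *
        (Matrix.of fun a b : Fin (m + 1) => B (if a.1 = 0 then 0 else a.1 + 1) b.1).det) := by
    have hrs : r ≠ s := by simp [r, s]
    have hp := Matrix.det_permute (Equiv.swap r s) (M.updateRow r v)
    rw [Equiv.Perm.sign_swap hrs] at hp
    have hp' : (M.updateRow r v).det = - ((M.updateRow r v).submatrix (Equiv.swap r s) id).det := by
      rw [hp]; simp
    rw [hp']
    congr 1
    rw [← Matrix.det_submatrix_equiv_self finSumFinEquiv,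
      ← Matrix.fromBlocks_toBlocks
        (((M.updateRow r v).submatrix (Equiv.swap r s) id).submatrix finSumFinEquiv finSumFinEquiv)]
    have h0 : (((M.updateRow r v).submatrix (Equiv.swap r s) id).submatrix
        finSumFinEquiv finSumFinEquiv).toBlocks₂₁ = 0 := by
      ext a b
      have := b.2
      simp only [Matrix.toBlocks₂₁, Matrix.of_apply, Matrix.submatrix_apply, hM, Matrix.updateRow_apply,
        finSumFinEquiv_apply_left, finSumFinEquiv_apply_right, r, s, v, Equiv.swap_apply_def,
        Fin.ext_iff, Fin.val_castAdd, apply_ite Fin.val, id,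
        Fin.val_natAdd, Matrix.zero_apply]
      split_ifs <;> first | rfl | omega
    rw [h0, Matrix.det_fromBlocks_zero₂₁]
    congr 2
    · ext a b
      have := a.2
      have := b.2
      simp only [Matrix.toBlocks₁₁, Matrix.of_apply, Matrix.submatrix_apply, hM, Matrix.updateRow_apply,
        finSumFinEquiv_apply_left, finSumFinEquiv_apply_right, r, s, v, Equiv.swap_apply_def,
        Fin.ext_iff, Fin.val_castAdd, apply_ite Fin.val, id,
        Fin.val_natAdd]
      split_ifs <;> first | rfl | omega
    · ext a b
      simp only [Matrix.toBlocks₂₂, Matrix.of_apply, Matrix.submatrix_apply, hM, Matrix.updateRow_apply,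
        finSumFinEquiv_apply_left, finSumFinEquiv_apply_right, r, s, v, Equiv.swap_apply_def,
        Fin.ext_iff, Fin.val_castAdd, apply_ite Fin.val, id,
        Fin.val_natAdd]
      split_ifs <;> first | rfl | omega | (congr 1 <;> first | omega | (congr 1; omega))
  rw [hsplit, Matrix.det_updateRow_add, h1, h2, sub_eq_add_neg]


/-- The determinant of the square block matrix
`M = [[X_{[i,β+1]}^{[j,n]}, 0], [0, X_{[α,n]}^{[1,n-α]}]]` (each block with one more row
than columns, the two blocks overlapping in two rows, `j = n + i - β`) equals
`det X_{[i,β]}^{[j,n]} · det X_{[α+1,n]}^{[1,n-α]}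
  - det X_{[i,…,β-1,β+1]}^{[j,n]} · det X_{[α,α+2,…,n]}^{[1,n-α]}`.
Indices are 1-based in the docstring, 0-based in the Lean code. -/
theorem psi_block_det {K : Type*} [CommRing K] (n i α β : ℕ)
    (hi : 1 ≤ i) (hiβ : i ≤ β) (hβ : β < n) (hα : 1 ≤ α) (hαn : α < n)
    (X : Matrix (Fin n) (Fin n) K) :
    (Matrix.of fun a b : Fin ((β - i + 1) + (n - α)) =>
      if hb : b.1 < β - i + 1 then
        if ha : a.1 ≤ β - i + 1 then
          X ⟨i - 1 + a.1, by omega⟩ ⟨n + i - β - 1 + b.1, by omega⟩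
        else 0
      else
        if ha : β - i ≤ a.1 then
          X ⟨α - 1 + (a.1 - (β - i)), by have := a.2; omega⟩
            ⟨b.1 - (β - i + 1), by have := b.2; omega⟩
        else 0).det
    = (Matrix.of fun a b : Fin (β - i + 1) =>
          X ⟨i - 1 + a.1, by have := a.2; omega⟩
            ⟨n + i - β - 1 + b.1, by have := b.2; omega⟩).det *
        (Matrix.of fun a b : Fin (n - α) =>
          X ⟨α + a.1, by have := a.2; omega⟩ ⟨b.1, by have := b.2; omega⟩).det
      - (Matrix.of fun a b : Fin (β - i + 1) =>
          X ⟨if a.1 < β - i then i - 1 + a.1 else β, by have := a.2; split <;> omega⟩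
            ⟨n + i - β - 1 + b.1, by have := b.2; omega⟩).det *
        (Matrix.of fun a b : Fin (n - α) =>
          X ⟨if a.1 = 0 then α - 1 else α + a.1, by have := a.2; split <;> omega⟩
            ⟨b.1, by have := b.2; omega⟩).det := by
  obtain ⟨p, rfl⟩ : ∃ p, β = i + p := ⟨β - i, by omega⟩
  obtain ⟨m, rfl⟩ : ∃ m, n = α + (m + 1) := ⟨n - α - 1, by omega⟩
  have e1 : i + p - i = p := by omega
  have e2 : α + (m + 1) - α = m + 1 := by omega
  let Y : ℕ → ℕ → K := fun a b =>
    if h : a < α + (m + 1) ∧ b < α + (m + 1) then X ⟨a, h.1⟩ ⟨b, h.2⟩ else 0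
  have hY : ∀ a b (ha : a < α + (m + 1)) (hb : b < α + (m + 1)), X ⟨a, ha⟩ ⟨b, hb⟩ = Y a b := by
    intro a b ha hb
    simp [Y, ha, hb]
  simp only [hY, dite_eq_ite]
  clear_value Y
  rw [e1, e2]
  have key := psi_aux p m (fun a b => Y (i - 1 + a) (α + (m + 1) + i - (i + p) - 1 + b))
    (fun a b => Y (α - 1 + a) b)
  convert key using 8 <;> first | omega | (split_ifs <;> omega)
end
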